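/- Let P ⊂ ℝ² be a convex lattice polygon of nonzero area with h = ls_□(P). Then A(P) = h/2 if and only if P is lattice-equivalent to the triangle conv{(0,0), (h,0), (0,1)}. -/

import Mathlib

open Set MeasureTheory Pointwise

/-- A plane convex body: a compact convex subset of ℝ² with nonempty interior. -/
def IsPlaneConvexBody (P : Set (Fin 2 → ℝ)) : Prop :=
  IsCompact P ∧ Convex ℝ P ∧ (interior P).Nonempty

/-- The width of `P` in the direction `u`. -/
noncomputable def width (P : Set (Fin 2 → ℝ)) (u : Fin 2 → ℝ) : ℝ :=
  sSup ((fun p => u 0 * p 0 + u 1 * p 1) '' P) -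
    sInf ((fun p => u 0 * p 0 + u 1 * p 1) '' P)

/-- An affine unimodular transformation: multiplication by an integer matrix with
determinant `±1` followed by a translation by an integer vector. -/
def IsUnimodularMap (φ : (Fin 2 → ℝ) → (Fin 2 → ℝ)) : Prop :=
  ∃ (A : Matrix (Fin 2) (Fin 2) ℤ) (t : Fin 2 → ℤ),
    (A.det = 1 ∨ A.det = -1) ∧
    ∀ x, φ x = (A.map (Int.cast : ℤ → ℝ)).mulVec x + fun i => (t i : ℝ)

/-- Two subsets of ℝ² are lattice-equivalent if one is the image of the other
under an affine unimodular transformation. -/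
def LatticeEquivalent (P Q : Set (Fin 2 → ℝ)) : Prop :=
  ∃ φ, IsUnimodularMap φ ∧ Q = φ '' P

/-- The `l`-dilate of the unit square, `[0,l]²`. -/
def squareDilate (l : ℝ) : Set (Fin 2 → ℝ) :=
  {x | ∀ i, x i ∈ Set.Icc 0 l}

/-- The `l`-dilate of the standard 2-simplex. -/
def simplexDilate (l : ℝ) : Set (Fin 2 → ℝ) :=
  {x | 0 ≤ x 0 ∧ 0 ≤ x 1 ∧ x 0 + x 1 ≤ l}

/-- The lattice size of `P` with respect to the unit square. -/
noncomputable def lsSquare (P : Set (Fin 2 → ℝ)) : ℝ :=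
  sInf {l : ℝ | 0 ≤ l ∧ ∃ φ, IsUnimodularMap φ ∧ φ '' P ⊆ squareDilate l}

/-- The lattice size of `P` with respect to the standard simplex. -/
noncomputable def lsDelta (P : Set (Fin 2 → ℝ)) : ℝ :=
  sInf {l : ℝ | 0 ≤ l ∧ ∃ φ, IsUnimodularMap φ ∧ φ '' P ⊆ simplexDilate l}

/-- The lattice width of `P`: the minimum of `width P u` over primitive integer
directions `u`. -/
noncomputable def latticeWidth (P : Set (Fin 2 → ℝ)) : ℝ :=
  sInf {w : ℝ | ∃ u : Fin 2 → ℤ, Int.gcd (u 0) (u 1) = 1 ∧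
    w = width P (fun i => (u i : ℝ))}

/-- A lattice polygon: the convex hull of a (nonempty) finite set of points of ℤ². -/
def IsLatticePolygon (P : Set (Fin 2 → ℝ)) : Prop :=
  ∃ S : Finset (Fin 2 → ℤ), S.Nonempty ∧
    P = convexHull ℝ ((fun p : Fin 2 → ℤ => fun i => (p i : ℝ)) '' (S : Set (Fin 2 → ℤ)))

/-- The area of a plane set: its two-dimensional Lebesgue measure. -/
noncomputable def area (P : Set (Fin 2 → ℝ)) : ℝ :=
  (volume P).toReal


/-- twice the signed area of a triangle, in integer coordinates -/
def triDet (x y : ι → ℤ) (L R T : ι) : ℤ :=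
  (x R - x L) * (y T - y L) - (y R - y L) * (x T - x L)

theorem core_two_le {ι : Type*} (S : Finset ι) (hS : S.Nonempty) (x y : ι → ℤ) (w : ℤ) (hw : 2 ≤ w)
    (hx : ∀ p ∈ S, 0 ≤ x p ∧ x p ≤ w) 
    (Hw : ∀ a b c d s n : ℤ, (a * d - b * c = 1 ∨ a * d - b * c = -1) →
      (∀ p ∈ S, 0 ≤ a * x p + b * y p + s ∧ a * x p + b * y p + s ≤ n) → w ≤ n)
    (Hd : ∀ a b c d s t l : ℤ, (a * d - b * c = 1 ∨ a * d - b * c = -1) →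
      (∀ p ∈ S, (0 ≤ a * x p + b * y p + s ∧ a * x p + b * y p + s ≤ l) ∧
        (0 ≤ c * x p + d * y p + t ∧ c * x p + d * y p + t ≤ l)) →
      ∀ L ∈ S, ∀ R ∈ S, ∀ T ∈ S, ∀ B ∈ S, 0 ≤ triDet x y L R T → triDet x y L R B ≤ 0 →
        triDet x y L R T - triDet x y L R B ≤ l) : False := by
  obtain ⟨L, hL, hL0⟩ : ∃ L ∈ S, x L = 0 := by
    by_contra! hcon
    have := Hw 1 0 0 1 (-1) (w - 1) (by norm_num) (fun p hp => by
      have := hx p hp; have := hcon p hp; omega)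
    omega
  obtain ⟨R, hR, hR0⟩ : ∃ L ∈ S, x L = w := by
    by_contra! hcon
    have := Hw 1 0 0 1 0 (w - 1) (by norm_num) (fun p hp => by
      have := hx p hp; have := hcon p hp; omega)
    omega
  -- main estimate
  have key : ∀ L ∈ S, ∀ R ∈ S, x L = 0 → x R = w → ∀ r k : ℤ, y R - y L = k * w + r → 2 * |r| ≤ w →
      w = 2 ∧ |r| = 1 ∧ ∀ p ∈ S, |triDet x y L R p| ≤ 2 := by
    clear! L R
    intro L hL R hR hL0 hR0 r k hk hr
    obtain ⟨T, hT, hTm⟩ := S.exists_max_image (triDet x y L R) hS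
    obtain ⟨B, hB, hBm⟩ := S.exists_min_image (triDet x y L R) hS
    have hLz : triDet x y L R L = 0 := by simp [triDet]
    have hT0 : 0 ≤ triDet x y L R T := hLz ▸ hTm L hL
    have hB0 : triDet x y L R B ≤ 0 := hLz ▸ hBm L hL
    obtain ⟨M, hM, hMm⟩ := S.exists_max_image (fun p => y p - k * x p) hS
    obtain ⟨N, hN, hNm⟩ := S.exists_min_image (fun p => y p - k * x p) hS
    set n := (y M - k * x M) - (y N - k * x N) with hn
    have hwn : w ≤ n := Hw (-k) 1 1 0 (-(y N - k * x N)) n (by norm_num) (fun p hp => by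
      have h1 := hMm p hp; have h2 := hNm p hp
      constructor <;> linarith)
    have hUV := Hd 1 0 (-k) 1 0 (-(y N - k * x N)) n (by norm_num) (fun p hp => by
      have h1 := hMm p hp; have h2 := hNm p hp; have h3 := hx p hp
      refine ⟨⟨by linarith, by linarith⟩, ?_, ?_⟩ <;> linarith) L hL R hR T hT B hB hT0 hB0
    have hz : ∀ p, triDet x y L R p = w * (y p - k * x p - y L) - r * x p := by
      intro p; simp only [triDet, hL0, hR0, hk]; ring
    have e1 := hTm M hM
    have e2 := hBm N hN
    have hbig : w * n ≤ n + |r| * w := by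
      have : w * n = triDet x y L R M - triDet x y L R N + r * (x M - x N) := by
        rw [hz, hz, hn]; ring
      have h3 : r * (x M - x N) ≤ |r| * w := by
        calc r * (x M - x N) ≤ |r * (x M - x N)| := le_abs_self _
          _ = |r| * |x M - x N| := abs_mul _ _
          _ ≤ |r| * w := by
            apply mul_le_mul_of_nonneg_left _ (abs_nonneg _)
            have := hx M hM; have := hx N hN
            rw [abs_le]; constructor <;> linarith
      linarith
    have hw2 : w = 2 := by nlinarith
    subst hw2
    have hr1 : |r| = 1 := by omega
    refine ⟨rfl, hr1, fun p hp => ?_⟩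
    have := hTm p hp
    have := hBm p hp
    rw [hr1] at hbig
    rw [abs_le]; constructor <;> linarith
  -- choose remainder
  have hex : ∀ q : ℤ, ∃ r k : ℤ, q = k * w + r ∧ 2 * |r| ≤ w := by
    intro q
    have h1 := Int.emod_add_mul_ediv q w
    have h2 := Int.emod_nonneg q (by omega : w ≠ 0)
    have h3 := Int.emod_lt_of_pos q (by omega : 0 < w)
    by_cases h : 2 * (q % w) ≤ w
    · exact ⟨q % w, q / w, by linarith, by rwa [abs_of_nonneg h2]⟩
    · exact ⟨q % w - w, q / w + 1, by linarith, by rw [abs_of_neg (by linarith)]; linarith⟩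
  have key2 : ∀ L ∈ S, ∀ R ∈ S, x L = 0 → x R = w →
      w = 2 ∧ (y R - y L) % 2 = 1 ∧ ∀ p ∈ S, |triDet x y L R p| ≤ 2 := by
    intro L hL R hR h0 h1
    obtain ⟨r, k, e, hr⟩ := hex (y R - y L)
    obtain ⟨a, b, c⟩ := key L hL R hR h0 h1 r k e hr
    refine ⟨a, ?_, c⟩
    subst a
    rcases abs_choice r with h | h <;> omega
  obtain ⟨hw2, hodd, habs⟩ := key2 L hL R hR hL0 hR0
  subst hw2
  obtain ⟨k, hk⟩ : ∃ k, y R - y L = 2 * k + 1 := ⟨(y R - y L) / 2, by omega⟩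
  have := Hw (-k) 1 1 0 (- y L) 1 (by norm_num) (fun p hp => by
    have hp1 := hx p hp
    have hp2 := habs p hp
    simp only [triDet, hL0, hR0, hk] at hp2
    rw [abs_le] at hp2
    have h02 : x p = 0 ∨ x p = 1 ∨ x p = 2 := by omega
    rcases h02 with h | h | h
    · have := (key2 p hp R hR h hR0).2.1
      rw [h] at hp2 ⊢
      omega
    · rw [h] at hp2 ⊢
      omega
    · have := (key2 L hL p hp hL0 h).2.1
      rw [h] at hp2 ⊢
      omega)
  omega

theorem core_one {ι : Type*} (S : Finset ι) (x y : ι → ℤ) (h : ℝ)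
    (hx : ∀ p ∈ S, 0 ≤ x p ∧ x p ≤ 1) 
    (Hw : ∀ a b c d s n : ℤ, (a * d - b * c = 1 ∨ a * d - b * c = -1) →
      (∀ p ∈ S, 0 ≤ a * x p + b * y p + s ∧ a * x p + b * y p + s ≤ n) → 1 ≤ n)
    (Hl : ∀ a b c d s t l : ℤ, (a * d - b * c = 1 ∨ a * d - b * c = -1) →
      (∀ p ∈ S, (0 ≤ a * x p + b * y p + s ∧ a * x p + b * y p + s ≤ l) ∧
        (0 ≤ c * x p + d * y p + t ∧ c * x p + d * y p + t ≤ l)) → h ≤ l)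
    (Hd : ∀ L ∈ S, ∀ R ∈ S, ∀ T ∈ S, ∀ B ∈ S, 0 ≤ triDet x y L R T → triDet x y L R B ≤ 0 →
        ((triDet x y L R T - triDet x y L R B : ℤ) : ℝ) ≤ h) :
    ∃ a b c d s t k : ℤ, (a * d - b * c = 1 ∨ a * d - b * c = -1) ∧ h = k ∧ 
      (∀ p ∈ S, (c * x p + d * y p + t = 0 ∧ 0 ≤ a * x p + b * y p + s ∧ a * x p + b * y p + s ≤ k) ∨
        (c * x p + d * y p + t = 1 ∧ a * x p + b * y p + s = 0)) ∧
      (∃ p ∈ S, c * x p + d * y p + t = 0 ∧ a * x p + b * y p + s = 0) ∧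
      (∃ p ∈ S, c * x p + d * y p + t = 0 ∧ a * x p + b * y p + s = k) ∧
      (∃ p ∈ S, c * x p + d * y p + t = 1 ∧ a * x p + b * y p + s = 0) := by
  obtain ⟨L, hL, hL0⟩ : ∃ L ∈ S, x L = 0 := by
    by_contra! hcon
    have := Hw 1 0 0 1 (-1) 0 (by norm_num) (fun p hp => by
      have := hx p hp; have := hcon p hp; omega)
    omega
  obtain ⟨R, hR, hR0⟩ : ∃ L ∈ S, x L = 1 := by
    by_contra! hcon
    have := Hw 1 0 0 1 0 0 (by norm_num) (fun p hp => by
      have := hx p hp; have := hcon p hp; omega)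
    omega
  obtain ⟨T0, hT0, hT0m⟩ := (S.filter (x · = 0)).exists_max_image y ⟨L, by simp [hL, hL0]⟩
  obtain ⟨B0, hB0, hB0m⟩ := (S.filter (x · = 0)).exists_min_image y ⟨L, by simp [hL, hL0]⟩
  obtain ⟨T1, hT1, hT1m⟩ := (S.filter (x · = 1)).exists_max_image y ⟨R, by simp [hR, hR0]⟩
  obtain ⟨B1, hB1, hB1m⟩ := (S.filter (x · = 1)).exists_min_image y ⟨R, by simp [hR, hR0]⟩
  have g0 := hB0m T0 hT0
  have g1 := hB1m T1 hT1
  simp only [Finset.mem_filter, and_imp] at hT0 hT0m hB0 hB0m hT1 hT1m hB1 hB1m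
  have hdet := Hd B0 hB0.1 T1 hT1.1 T0 hT0.1 B1 hB1.1 
    (by simp only [triDet, hT0.2, hB0.2, hT1.2]; linarith)
    (by simp only [triDet, hB1.2, hB0.2, hT1.2]; linarith)
  have e : triDet x y B0 T1 T0 - triDet x y B0 T1 B1 = (y T0 - y B0) + (y T1 - y B1) := by
    simp only [triDet, hB1.2, hB0.2, hT1.2, hT0.2]; ring
  rw [e] at hdet
  clear e
  set m := max (y T0 - y B0) (y T1 - y B1) with hm
  have hfit : ∀ p ∈ S, 0 ≤ (-(y B1 - y B0)) * x p + 1 * y p + (- y B0) ∧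
      (-(y B1 - y B0)) * x p + 1 * y p + (- y B0) ≤ m := by
    intro p hp
    have := hx p hp
    have : x p = 0 ∨ x p = 1 := by omega
    rcases this with h' | h'
    · have := hB0m p hp h'; have := hT0m p hp h'
      rw [h']; omega
    · have := hB1m p hp h'; have := hT1m p hp h'
      rw [h']; omega
  have hm1 : 1 ≤ m := Hw _ _ 1 0 _ _ (by norm_num) hfit
  have hhm : h ≤ m := Hl _ _ 1 0 _ 0 _ (by norm_num) (fun p hp => ⟨hfit p hp, by
    have := hx p hp; omega⟩)
  have hle : (y T0 - y B0) + (y T1 - y B1) ≤ m := by exact_mod_cast hdet.trans hhm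
  have hhm' : h = m := by
    apply le_antisymm hhm
    refine le_trans ?_ hdet
    norm_cast
    omega
  rcases le_total (y T1 - y B1) (y T0 - y B0) with hc | hc
  · refine ⟨-(y B1 - y B0), 1, 1, 0, - y B0, 0, m, by norm_num, hhm', ?_, ⟨B0, hB0.1, ?_⟩,
      ⟨T0, hT0.1, ?_⟩, ⟨B1, hB1.1, ?_⟩⟩
    · intro p hp
      have := hx p hp
      have h1 := hfit p hp
      have : x p = 0 ∨ x p = 1 := by omega
      rcases this with h' | h'
      · left; rw [h'] at h1 ⊢; omega
      · right
        have := hB1m p hp h'; have := hT1m p hp h'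
        rw [h']; omega
    · rw [hB0.2]; omega
    · rw [hT0.2]; omega
    · rw [hB1.2]; omega
  · refine ⟨-(y B1 - y B0), 1, -1, 0, - y B0, 1, m, by norm_num, hhm', ?_, ⟨B1, hB1.1, ?_⟩,
      ⟨T1, hT1.1, ?_⟩, ⟨B0, hB0.1, ?_⟩⟩
    · intro p hp
      have := hx p hp
      have h1 := hfit p hp
      have : x p = 0 ∨ x p = 1 := by omega
      rcases this with h' | h'
      · right
        have := hB0m p hp h'; have := hT0m p hp h'
        rw [h']; omega
      · left; rw [h'] at h1 ⊢; omega
    · rw [hB1.2]; omega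
    · rw [hT1.2]; omega
    · rw [hB0.2]; omega

/-- The affine map `x ↦ M x + t`. -/
noncomputable def matAff (M : Matrix (Fin 2) (Fin 2) ℝ) (t : Fin 2 → ℝ) :
    (Fin 2 → ℝ) →ᵃ[ℝ] (Fin 2 → ℝ) :=
  (Matrix.mulVecLin M).toAffineMap + AffineMap.const ℝ (Fin 2 → ℝ) t

theorem matAff_apply (M : Matrix (Fin 2) (Fin 2) ℝ) (t x : Fin 2 → ℝ) :
    matAff M t x = M.mulVec x + t := by
  simp [matAff]

theorem volume_matAff_image (M : Matrix (Fin 2) (Fin 2) ℝ) (t : Fin 2 → ℝ) (s : Set (Fin 2 → ℝ)) :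
    volume (matAff M t '' s) = ENNReal.ofReal |M.det| * volume s := by
  have : matAff M t '' s = (fun x => x + t) '' (Matrix.mulVecLin M '' s) := by
    rw [Set.image_image]
    apply Set.image_congr
    intro x _
    rw [matAff_apply]; rfl
  rw [this, Set.image_add_right, measure_preimage_add_right, Measure.addHaar_image_linearMap]
  congr 3
  rw [← Matrix.toLin'_apply', LinearMap.det_toLin']

theorem volume_line (a b c : ℝ) (h : a ≠ 0 ∨ b ≠ 0) :
    volume {p : Fin 2 → ℝ | a * p 0 + b * p 1 = c} = 0 := by
  rcases Set.eq_empty_or_nonempty {p : Fin 2 → ℝ | a * p 0 + b * p 1 = c} with h0 | ⟨q, hq⟩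
  · rw [h0]; simp
  let f : (Fin 2 → ℝ) →ₗ[ℝ] ℝ :=
    a • LinearMap.proj (0 : Fin 2) + b • LinearMap.proj (1 : Fin 2)
  have hf : ∀ p, f p = a * p 0 + b * p 1 := fun p => by simp [f]
  have : {p : Fin 2 → ℝ | a * p 0 + b * p 1 = c} =
      (AffineSubspace.mk' q (LinearMap.ker f) : Set (Fin 2 → ℝ)) := by
    ext p
    simp only [Set.mem_ofPred_eq] at hq
    simp only [Set.mem_ofPred_eq, SetLike.mem_coe, AffineSubspace.mem_mk', vsub_eq_sub,
      LinearMap.mem_ker, hf, Pi.sub_apply]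
    constructor <;> intro h <;> linarith
  rw [this]
  apply Measure.addHaar_affineSubspace
  intro htop
  have hall : ∀ p, p ∈ AffineSubspace.mk' q (LinearMap.ker f) := fun p => by
    rw [htop]; trivial
  simp only [AffineSubspace.mem_mk', vsub_eq_sub, LinearMap.mem_ker, hf, Pi.sub_apply] at hall
  have h1 := hall (q + ![1, 0])
  have h2 := hall (q + ![0, 1])
  simp at h1 h2
  tauto

/-- The standard triangle. -/
def stdTri : Set (Fin 2 → ℝ) := {p | 0 ≤ p 0 ∧ 0 ≤ p 1 ∧ p 0 + p 1 ≤ 1}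

theorem stdTri_measurable : MeasurableSet stdTri := by
  have : IsClosed stdTri := by
    have h1 : IsClosed {p : Fin 2 → ℝ | 0 ≤ p 0} := isClosed_le (by fun_prop) (by fun_prop)
    have h2 : IsClosed {p : Fin 2 → ℝ | 0 ≤ p 1} := isClosed_le (by fun_prop) (by fun_prop)
    have h3 : IsClosed {p : Fin 2 → ℝ | p 0 + p 1 ≤ 1} := isClosed_le (by fun_prop) (by fun_prop)
    exact h1.inter (h2.inter h3)
  exact this.measurableSet

theorem volume_stdTri : volume stdTri = ENNReal.ofReal (1 / 2) := by
  let T' := matAff (-1) 1 '' stdTri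
  have hT' : volume T' = volume stdTri := by
    simp [T', volume_matAff_image, Matrix.det_neg]
  have hmem : ∀ p, p ∈ T' ↔ p 0 ≤ 1 ∧ p 1 ≤ 1 ∧ 1 ≤ p 0 + p 1 := by
    intro p
    simp only [T', Set.mem_image, matAff_apply, stdTri, Set.mem_ofPred_eq]
    constructor
    · rintro ⟨x, ⟨h1, h2, h3⟩, rfl⟩
      simp only [Matrix.neg_mulVec, Matrix.one_mulVec, Pi.add_apply, Pi.neg_apply, Pi.one_apply]
      refine ⟨?_, ?_, ?_⟩ <;> linarith
    · rintro ⟨h1, h2, h3⟩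
      refine ⟨1 - p, ⟨?_, ?_, ?_⟩, ?_⟩
      · simp only [Pi.sub_apply, Pi.one_apply]; linarith
      · simp only [Pi.sub_apply, Pi.one_apply]; linarith
      · simp only [Pi.sub_apply, Pi.one_apply]; linarith
      · simp [Matrix.neg_mulVec]
  have hsq : volume (stdTri ∪ T') = 1 := by
    have : stdTri ∪ T' = Set.Icc (0 : Fin 2 → ℝ) 1 := by
      ext p
      simp only [Set.mem_union, hmem, stdTri, Set.mem_ofPred_eq, Set.mem_Icc, Pi.le_def,
        Fin.forall_fin_two, Pi.zero_apply, Pi.one_apply]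
      constructor
      · rintro (⟨h1, h2, h3⟩ | ⟨h1, h2, h3⟩) <;> refine ⟨⟨?_, ?_⟩, ?_, ?_⟩ <;> linarith
      · rintro ⟨⟨h1, h2⟩, h3, h4⟩
        rcases le_total (p 0 + p 1) 1 with h | h
        · left; exact ⟨h1, h2, h⟩
        · right; exact ⟨h3, h4, h⟩
    rw [this, Real.volume_Icc_pi]; simp
  have hdis : AEDisjoint volume T' stdTri := by
    refine measure_mono_null ?_ (volume_line 1 1 1 (by norm_num))
    rintro p ⟨h1, h2⟩
    rw [hmem] at h1
    obtain ⟨-, -, h2⟩ := h2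
    simp only [Set.mem_ofPred_eq]; linarith
  rw [Set.union_comm, measure_union₀ stdTri_measurable.nullMeasurableSet hdis, hT'] at hsq
  have hfin : volume stdTri ≠ ⊤ := by
    intro h; rw [h] at hsq; simp at hsq
  rw [← ENNReal.ofReal_toReal hfin]
  congr 1
  have := congrArg ENNReal.toReal hsq
  rw [ENNReal.toReal_add hfin hfin] at this
  simp at this
  linarith

theorem hull_stdTri : convexHull ℝ {(![0, 0] : Fin 2 → ℝ), ![1, 0], ![0, 1]} = stdTri := by
  apply Set.Subset.antisymm
  · apply convexHull_min
    · rintro p (rfl | rfl | rfl) <;> simp [stdTri]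
    · intro p hp q hq a b ha hb hab
      obtain ⟨h1, h2, h3⟩ := hp
      obtain ⟨h4, h5, h6⟩ := hq
      simp only [stdTri, Set.mem_ofPred_eq, Pi.add_apply, Pi.smul_apply, smul_eq_mul]
      refine ⟨by positivity, by positivity, ?_⟩
      have : a * (p 0 + p 1) + b * (q 0 + q 1) ≤ a * 1 + b * 1 := by gcongr
      linarith
  · rintro p ⟨h1, h2, h3⟩
    have key := (convex_convexHull ℝ {(![0, 0] : Fin 2 → ℝ), ![1, 0], ![0, 1]}).sum_mem
      (t := Finset.univ) (w := ![1 - p 0 - p 1, p 0, p 1])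
      (z := ![(![0, 0] : Fin 2 → ℝ), ![1, 0], ![0, 1]])
      (by intro i _; fin_cases i <;> simp <;> linarith)
      (by simp [Fin.sum_univ_three]; ring)
      (by intro i _; apply subset_convexHull; fin_cases i <;> simp)
    convert key using 1
    ext i
    fin_cases i <;> simp [Fin.sum_univ_three]

/-- The triangle formula. -/
theorem volume_triangle (A B C : Fin 2 → ℝ) :
    volume (convexHull ℝ {A, B, C}) = ENNReal.ofReal
      (|(B 0 - A 0) * (C 1 - A 1) - (B 1 - A 1) * (C 0 - A 0)| / 2) := by
  let M : Matrix (Fin 2) (Fin 2) ℝ := !![B 0 - A 0, C 0 - A 0; B 1 - A 1, C 1 - A 1]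
  have : ({A, B, C} : Set (Fin 2 → ℝ)) =
      matAff M A '' {(![0, 0] : Fin 2 → ℝ), ![1, 0], ![0, 1]} := by
    simp only [Set.image_insert_eq, Set.image_singleton, matAff_apply]
    congr 1
    · ext i; fin_cases i <;> simp [M]
    congr 1
    · ext i; fin_cases i <;> simp [M]
    congr 1
    · ext i; fin_cases i <;> simp [M]
  rw [this, ← AffineMap.image_convexHull, hull_stdTri, volume_matAff_image, volume_stdTri,
    ← ENNReal.ofReal_mul (abs_nonneg _), Matrix.det_fin_two]
  congr 1
  simp only [M, Matrix.of_apply, Matrix.cons_val', Matrix.cons_val_zero, Matrix.cons_val_one,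
    Matrix.cons_val_fin_one]
  rw [mul_comm (C 0 - A 0)]
  ring

/-- The real determinant. -/
def rDet (L R T : Fin 2 → ℝ) : ℝ :=
  (R 0 - L 0) * (T 1 - L 1) - (R 1 - L 1) * (T 0 - L 0)

theorem hull_side (L R T : Fin 2 → ℝ) (hT : 0 ≤ rDet L R T) :
    convexHull ℝ {L, R, T} ⊆ {p | 0 ≤ rDet L R p} := by
  apply convexHull_min
  · rintro p (rfl | rfl | rfl)
    · simp [rDet]
    · simp only [Set.mem_ofPred_eq, rDet]; apply le_of_eq; ring
    · exact hT
  · intro p hp q hq a b ha hb hab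
    simp only [Set.mem_ofPred_eq] at hp hq ⊢
    have : rDet L R (a • p + b • q) = a * rDet L R p + b * rDet L R q := by
      obtain rfl : b = 1 - a := by linarith
      simp only [rDet, Pi.add_apply, Pi.smul_apply, smul_eq_mul]; ring
    rw [this]; positivity

theorem hull_side' (L R T : Fin 2 → ℝ) (hT : rDet L R T ≤ 0) :
    convexHull ℝ {L, R, T} ⊆ {p | rDet L R p ≤ 0} := by
  have := hull_side R L T (by simp only [rDet] at *; linarith)
  rw [Set.insert_comm]
  refine this.trans ?_
  intro p hp
  simp only [Set.mem_ofPred_eq, rDet] at *; linarith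

theorem quad_area (P : Set (Fin 2 → ℝ)) (hP : Convex ℝ P) (hfin : volume P ≠ ⊤)
    (L R T B : Fin 2 → ℝ)
    (hL : L ∈ P) (hR : R ∈ P) (hT : T ∈ P) (hB : B ∈ P)
    (h1 : 0 ≤ rDet L R T) (h2 : rDet L R B ≤ 0) :
    (rDet L R T - rDet L R B) / 2 ≤ area P := by
  by_cases hLR : R 0 - L 0 = 0 ∧ R 1 - L 1 = 0
  · simp only [rDet, hLR, area]; simp
  have hsub : convexHull ℝ {L, R, T} ∪ convexHull ℝ {L, R, B} ⊆ P := by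
    apply Set.union_subset <;> apply convexHull_min _ hP
    · rintro p (rfl | rfl | rfl) <;> assumption
    · rintro p (rfl | rfl | rfl) <;> assumption
  have hdis : AEDisjoint volume (convexHull ℝ {L, R, T}) (convexHull ℝ {L, R, B}) := by
    refine measure_mono_null ?_ (volume_line (-(R 1 - L 1)) (R 0 - L 0)
      ((R 0 - L 0) * L 1 - (R 1 - L 1) * L 0) (by
        rw [neg_ne_zero]; tauto))
    rintro p ⟨g1, g2⟩
    have g1 := hull_side _ _ _ h1 g1
    have g2 := hull_side' _ _ _ h2 g2
    simp only [Set.mem_ofPred_eq, rDet] at *; linarith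
  have hmeas : MeasurableSet (convexHull ℝ {L, R, B}) :=
    (Set.Finite.isCompact_convexHull ℝ (Set.toFinite {L, R, B})).isClosed.measurableSet
  have := measure_mono (μ := volume) hsub
  rw [measure_union₀ hmeas.nullMeasurableSet hdis, volume_triangle, volume_triangle] at this
  rw [← ENNReal.ofReal_add (by positivity) (by positivity)] at this
  have h3 := ENNReal.toReal_mono hfin this
  rw [ENNReal.toReal_ofReal (by positivity)] at h3
  change _ ≤ area P at h3
  change |rDet L R T| / 2 + |rDet L R B| / 2 ≤ _ at h3
  rw [abs_of_nonneg h1, abs_of_nonpos h2] at h3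
  linarith

theorem unimodular_eq {φ : (Fin 2 → ℝ) → (Fin 2 → ℝ)} (h : IsUnimodularMap φ) :
    ∃ M t, |Matrix.det M| = 1 ∧ φ = matAff M t := by
  obtain ⟨A, t, hdet, hφ⟩ := h
  refine ⟨A.map (Int.cast : ℤ → ℝ), fun i => (t i : ℝ), ?_, ?_⟩
  · have : (A.map (Int.cast : ℤ → ℝ)).det = (A.det : ℝ) := (Int.cast_det A).symm
    rw [this]
    rcases hdet with h | h <;> simp [h]
  · funext x; rw [hφ, matAff_apply]

theorem lsSquare_nonneg (P : Set (Fin 2 → ℝ)) : 0 ≤ lsSquare P :=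
  Real.sInf_nonneg fun _ h => h.1

theorem area_of_equiv (P : Set (Fin 2 → ℝ)) (h : ℝ) (h0 : 0 ≤ h)
    (he : LatticeEquivalent P (convexHull ℝ {(![0, 0] : Fin 2 → ℝ), ![h, 0], ![0, 1]})) :
    area P = h / 2 := by
  obtain ⟨φ, hφ, he⟩ := he
  obtain ⟨M, t, hM, rfl⟩ := unimodular_eq hφ
  have := congrArg volume he
  rw [volume_matAff_image, hM, volume_triangle] at this
  simp at this
  rw [area, ← this, ENNReal.toReal_ofReal (by positivity), abs_of_nonneg h0]

theorem explicit_unimodular (a b c d s t : ℤ) (h : a * d - b * c = 1 ∨ a * d - b * c = -1) :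
    ∃ φ : (Fin 2 → ℝ) →ᵃ[ℝ] (Fin 2 → ℝ), IsUnimodularMap φ ∧
      ∀ x, φ x = ![a * x 0 + b * x 1 + s, c * x 0 + d * x 1 + t] := by
  refine ⟨matAff (!![a, b; c, d].map (Int.cast : ℤ → ℝ)) (fun i => ((![s, t] i : ℤ) : ℝ)),
    ⟨!![a, b; c, d], ![s, t], ?_, fun x => matAff_apply _ _ _⟩, ?_⟩
  · rw [Matrix.det_fin_two_of]; exact h
  · intro x
    rw [matAff_apply]
    ext i; fin_cases i <;> simp 

theorem stmt10 (P : Set (Fin 2 → ℝ)) (hP : IsLatticePolygon P) (hA : area P ≠ 0) :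
    area P = lsSquare P / 2 ↔
      LatticeEquivalent P
        (convexHull ℝ {(![0, 0] : Fin 2 → ℝ), ![lsSquare P, 0], ![0, 1]}) := by
  refine ⟨?_, area_of_equiv P _ (lsSquare_nonneg P)⟩
  intro hE
  obtain ⟨S, hS, hPS⟩ := hP
  have hSP : ∀ p ∈ S, (fun i => (p i : ℝ)) ∈ P := by
    intro p hp
    rw [hPS]; apply subset_convexHull; exact ⟨p, hp, rfl⟩
  have hconv : Convex ℝ P := by rw [hPS]; exact convex_convexHull _ _
  have hfin : volume P ≠ ⊤ := by
    rw [hPS]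
    exact (Set.Finite.isCompact_convexHull ℝ (S.finite_toSet.image _)).measure_lt_top.ne
  have Hl : ∀ a b c d s t l : ℤ, (a * d - b * c = 1 ∨ a * d - b * c = -1) →
      (∀ p ∈ S, (0 ≤ a * p 0 + b * p 1 + s ∧ a * p 0 + b * p 1 + s ≤ l) ∧
        (0 ≤ c * p 0 + d * p 1 + t ∧ c * p 0 + d * p 1 + t ≤ l)) → lsSquare P ≤ l := by
    intro a b c d s t l hdet hfit
    obtain ⟨φ, hφ, hφe⟩ := explicit_unimodular a b c d s t hdet
    apply csInf_le ⟨0, fun _ h => h.1⟩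
    refine ⟨?_, φ, hφ, ?_⟩
    · obtain ⟨p, hp⟩ := hS
      have := (hfit p hp).1
      exact_mod_cast this.1.trans this.2
    · have hsq : squareDilate l = Set.Icc (0 : Fin 2 → ℝ) (fun _ => (l : ℝ)) := by
        ext x; simp [squareDilate, Pi.le_def]; tauto
      rw [hPS, AffineMap.image_convexHull]
      apply convexHull_min
      · rintro _ ⟨_, ⟨p, hp, rfl⟩, rfl⟩
        rw [hφe]
        have := hfit p hp
        intro i
        fin_cases i
        · simp only [Fin.zero_eta, Matrix.cons_val_zero, Set.mem_Icc]
          exact_mod_cast this.1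
        · simp only [Fin.mk_one, Matrix.cons_val_one, Matrix.cons_val_fin_one, Set.mem_Icc]
          exact_mod_cast this.2
      · rw [hsq]; exact convex_Icc _ _
  have Hd : ∀ L ∈ S, ∀ R ∈ S, ∀ T ∈ S, ∀ B ∈ S, 0 ≤ triDet (· 0) (· 1) L R T →
      triDet (· 0) (· 1) L R B ≤ 0 →
        ((triDet (· 0) (· 1) L R T - triDet (· 0) (· 1) L R B : ℤ) : ℝ) ≤ lsSquare P := by
    intro L hL R hR T hT B hB h1 h2
    have hcast : ∀ L R T : Fin 2 → ℤ, rDet (fun i => (L i : ℝ)) (fun i => (R i : ℝ))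
        (fun i => (T i : ℝ)) = (triDet (· 0) (· 1) L R T : ℤ) := by
      intro L R T; simp [rDet, triDet]
    have := quad_area P hconv hfin _ _ _ _ (hSP L hL) (hSP R hR) (hSP T hT) (hSP B hB)
      (by rw [hcast]; exact_mod_cast h1) (by rw [hcast]; exact_mod_cast h2)
    rw [hcast, hcast, hE] at this
    push_cast
    linarith
  have H0 : ∀ a b c d s : ℤ, (a * d - b * c = 1 ∨ a * d - b * c = -1) →
      ¬ (∀ p ∈ S, a * p 0 + b * p 1 + s = 0) := by
    intro a b c d s hdet hall
    apply hA
    have : volume P = 0 := by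
      refine measure_mono_null ?_ (volume_line a b (-s) ?_)
      · rw [hPS]
        apply convexHull_min
        · rintro _ ⟨p, hp, rfl⟩
          have := hall p hp
          simp only [Set.mem_ofPred_eq]
          have h2 : ((a * p 0 + b * p 1 + s : ℤ) : ℝ) = 0 := by rw [this]; simp
          push_cast at h2
          linarith
        · intro p hp q hq u v hu hv huv
          simp only [Set.mem_ofPred_eq, Pi.add_apply, Pi.smul_apply, smul_eq_mul] at *
          obtain rfl : v = 1 - u := by linarith
          linear_combination u * hp + (1 - u) * hq
      · by_contra! hab
        have ha : a = 0 := by exact_mod_cast hab.1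
        have hb : b = 0 := by exact_mod_cast hab.2
        subst ha; subst hb; simp at hdet
    rw [area, this]; rfl
  -- minimal width
  let Q : ℕ → Prop := fun n => ∃ a b c d s : ℤ, (a * d - b * c = 1 ∨ a * d - b * c = -1) ∧
      ∀ p ∈ S, 0 ≤ a * p 0 + b * p 1 + s ∧ a * p 0 + b * p 1 + s ≤ n
  have hQ : ∃ n, Q n := by
    obtain ⟨M, hM, hMm⟩ := S.exists_max_image (fun p => p 0) hS
    obtain ⟨N, hN, hNm⟩ := S.exists_min_image (fun p => p 0) hS
    refine ⟨(M 0 - N 0).toNat, 1, 0, 0, 1, - N 0, by norm_num, fun p hp => ?_⟩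
    have := hMm p hp; have := hNm p hp
    omega
  classical
  obtain ⟨a, b, c, d, s, hdet, hfit⟩ := Nat.find_spec hQ
  have hmin : ∀ n, Q n → Nat.find hQ ≤ n := fun n h => Nat.find_min' hQ h
  set w := Nat.find hQ with hw
  clear_value w
  have hw1 : 1 ≤ w := by
    by_contra! hlt
    obtain rfl : w = 0 := by omega
    exact H0 a b c d s hdet (fun p hp => by have := hfit p hp; push_cast at this; omega)
  let x : (Fin 2 → ℤ) → ℤ := fun p => a * p 0 + b * p 1 + s
  let y : (Fin 2 → ℤ) → ℤ := fun p => c * p 0 + d * p 1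
  have hcomp : ∀ a' b' c' d' : ℤ, (a' * d' - b' * c' = 1 ∨ a' * d' - b' * c' = -1) →
      ((a' * a + b' * c) * (c' * b + d' * d) - (a' * b + b' * d) * (c' * a + d' * c) = 1 ∨
      (a' * a + b' * c) * (c' * b + d' * d) - (a' * b + b' * d) * (c' * a + d' * c) = -1) := by
    intro a' b' c' d' h
    have : (a' * a + b' * c) * (c' * b + d' * d) - (a' * b + b' * d) * (c' * a + d' * c) =
      (a' * d' - b' * c') * (a * d - b * c) := by ring
    rw [this]
    rcases h with h | h <;> rcases hdet with h' | h' <;> rw [h, h'] <;> norm_num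
  have hxy : ∀ (a' b' s' : ℤ) (p : Fin 2 → ℤ), a' * x p + b' * y p + s' =
      (a' * a + b' * c) * p 0 + (a' * b + b' * d) * p 1 + (a' * s + s') := by
    intro a' b' s' p; simp only [x, y]; ring
  have Hw' : ∀ a b c d s n : ℤ, (a * d - b * c = 1 ∨ a * d - b * c = -1) →
      (∀ p ∈ S, 0 ≤ a * x p + b * y p + s ∧ a * x p + b * y p + s ≤ n) → (w : ℤ) ≤ n := by
    intro a' b' c' d' s' n hdet' hfit'
    have hn : 0 ≤ n := by
      obtain ⟨p, hp⟩ := hS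
      exact (hfit' p hp).1.trans (hfit' p hp).2
    obtain ⟨k, rfl⟩ := Int.eq_ofNat_of_zero_le hn
    have := hmin k ⟨_, _, _, _, a' * s + s', hcomp a' b' c' d' hdet', fun p hp => by
      have := hfit' p hp
      rwa [hxy] at this⟩
    exact_mod_cast this
  have Hl' : ∀ a b c d s t l : ℤ, (a * d - b * c = 1 ∨ a * d - b * c = -1) →
      (∀ p ∈ S, (0 ≤ a * x p + b * y p + s ∧ a * x p + b * y p + s ≤ l) ∧
        (0 ≤ c * x p + d * y p + t ∧ c * x p + d * y p + t ≤ l)) → lsSquare P ≤ l := by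
    intro a' b' c' d' s' t' l hdet' hfit'
    refine Hl _ _ _ _ (a' * s + s') (c' * s + t') l (hcomp a' b' c' d' hdet') fun p hp => ?_
    have := hfit' p hp
    rwa [hxy, hxy] at this
  have Hd' : ∀ L ∈ S, ∀ R ∈ S, ∀ T ∈ S, ∀ B ∈ S, 0 ≤ triDet x y L R T → triDet x y L R B ≤ 0 →
        ((triDet x y L R T - triDet x y L R B : ℤ) : ℝ) ≤ lsSquare P := by
    intro L hL R hR T hT B hB h1 h2
    have hD : ∀ L R T, triDet x y L R T = (a * d - b * c) * triDet (· 0) (· 1) L R T := by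
      intro L R T; simp only [triDet, x, y]; ring
    rw [hD] at h1 h2
    rw [hD, hD]
    rcases hdet with h | h
    · rw [h] at h1 h2 ⊢
      have := Hd L hL R hR T hT B hB (by linarith) (by linarith)
      simpa using this
    · rw [h] at h1 h2 ⊢
      have := Hd L hL R hR B hB T hT (by linarith) (by linarith)
      push_cast at this ⊢
      linarith
  have hw_one : w = 1 := by
    by_contra hne
    refine core_two_le S hS x y w (by omega) hfit Hw' ?_
    intro a b c d s t l hdet hf L hL R hR T hT B hB h1 h2
    exact_mod_cast (Hd' L hL R hR T hT B hB h1 h2).trans (Hl' a b c d s t l hdet hf)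
  subst hw_one
  obtain ⟨a', b', c', d', s', t', k, hdet', hk, hall, hv1, hv2, hv3⟩ :=
    core_one S x y (lsSquare P) hfit Hw' Hl' Hd'
  simp only [hxy] at hall hv1 hv2 hv3
  have hdd := hcomp a' b' c' d' hdet'
  generalize a' * a + b' * c = α at *
  generalize a' * b + b' * d = β at *
  generalize c' * a + d' * c = γ at *
  generalize c' * b + d' * d = δ at *
  generalize a' * s + s' = σ at *
  generalize c' * s + t' = τ at *
  obtain ⟨φ, hφ, hφe⟩ := explicit_unimodular α β γ δ σ τ hdd
  refine ⟨φ, hφ, ?_⟩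
  have hφi : ∀ p : Fin 2 → ℤ, φ (fun i => (p i : ℝ)) =
      ![((α * p 0 + β * p 1 + σ : ℤ) : ℝ), ((γ * p 0 + δ * p 1 + τ : ℤ) : ℝ)] := by
    intro p; rw [hφe]; push_cast; rfl
  rw [hk]
  have hPS' : φ '' P = convexHull ℝ (φ '' ((fun p : Fin 2 → ℤ => fun i => (p i : ℝ)) '' S)) := by
    rw [← AffineMap.image_convexHull, ← hPS]
  rw [hPS']
  apply Set.Subset.antisymm
  · apply convexHull_mono
    rintro _ (rfl | rfl | rfl)
    · obtain ⟨p, hp, e1, e2⟩ := hv1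
      exact ⟨_, ⟨p, hp, rfl⟩, by rw [hφi, e1, e2]; simp⟩
    · obtain ⟨p, hp, e1, e2⟩ := hv2
      exact ⟨_, ⟨p, hp, rfl⟩, by rw [hφi, e1, e2]; simp⟩
    · obtain ⟨p, hp, e1, e2⟩ := hv3
      exact ⟨_, ⟨p, hp, rfl⟩, by rw [hφi, e1, e2]; simp⟩
  · apply convexHull_min _ (convex_convexHull _ _)
    rintro _ ⟨_, ⟨p, hp, rfl⟩, rfl⟩
    rw [hφi]
    rcases hall p hp with ⟨e1, e2, e3⟩ | ⟨e1, e2⟩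
    · rw [e1]
      generalize α * p 0 + β * p 1 + σ = m at *
      have hsub : segment ℝ (![0, 0] : Fin 2 → ℝ) ![(k : ℝ), 0] ⊆
          convexHull ℝ {(![0, 0] : Fin 2 → ℝ), ![(k : ℝ), 0], ![0, 1]} :=
        segment_subset_convexHull (by simp) (by simp)
      apply hsub
      rcases eq_or_lt_of_le (e2.trans e3) with hk0 | hk0
      · obtain rfl : m = 0 := by omega
        simpa using left_mem_segment ℝ (![0, 0] : Fin 2 → ℝ) ![(k : ℝ), 0]
      · have hkr : (0 : ℝ) < k := by exact_mod_cast hk0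
        have hm0 : (0 : ℝ) ≤ m := by exact_mod_cast e2
        have hmk : (m : ℝ) ≤ k := by exact_mod_cast e3
        refine ⟨1 - m / k, m / k, ?_, by positivity, by ring, ?_⟩
        · rw [sub_nonneg, div_le_one hkr]; exact hmk
        · ext i; fin_cases i
          · simp; field_simp
          · simp
    · rw [e1, e2]
      apply subset_convexHull; simp
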